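/- arXiv:2408.15448 — 6 statements merged into one kernel-verified Lean document; each statement's English description precedes it below -/
import Mathlib

section
/- Let 0 < α ≤ 1, let u : ℝ^d → ℝ be continuously differentiable with ∇u Hölder continuous of exponent α, and assume ω is Hölder continuous of exponent α. Then for each x ∈ ℝ^d there exists a constant C < ∞ such that |D_δ u(x) − a · ∇u(x)| ≤ C δ^α for all δ > 0. -/
open MeasureTheory Metric Set
open scoped ENNReal Topology

/-- First-order Taylor estimate for a differentiable map with Hölder continuous derivative. -/
lemma norm_taylor_remainder_le_of_holder_fderiv {E F : Type*} [NormedAddCommGroup E]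
    [NormedSpace ℝ E] [NormedAddCommGroup F] [NormedSpace ℝ F] {u : E → F}
    (hu : Differentiable ℝ u) {K α : ℝ} (hα : 0 ≤ α)
    (hK : ∀ x y, ‖fderiv ℝ u x - fderiv ℝ u y‖ ≤ K * ‖x - y‖ ^ α) (x z : E) :
    ‖u (x + z) - u x - fderiv ℝ u x z‖ ≤ |K| * ‖z‖ ^ α * ‖z‖ := by
  have h := (convex_closedBall x ‖z‖).norm_image_sub_le_of_norm_fderiv_le' (𝕜 := ℝ) (f := u)
    (φ := fderiv ℝ u x) (C := |K| * ‖z‖ ^ α) (x := x) (y := x + z) (fun y _ => hu y)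
    (fun y hy => ?_) (by simp) (by simp)
  · simpa using h
  · rw [mem_closedBall_iff_norm] at hy
    calc _ ≤ K * ‖y - x‖ ^ α := hK y x
      _ ≤ |K| * ‖y - x‖ ^ α := by gcongr; exact le_abs_self K
      _ ≤ |K| * ‖z‖ ^ α := by gcongr

/-- Theorem (Operator Convergence), part (c).  Under the `L¹`-bounded
moments and convergence-of-moments hypotheses, if each kernel is supported in
`closedBall 0 δ`, `∇u` is `α`-Hölder, and `ω` is `α`-Hölder, then for each `x` there is a
constant `C` with `|D_δ u(x) − a·∇u(x)| ≤ C δ^α` for all `δ > 0`. -/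
theorem nonlocal_derivative_pointwise_rate
    {d : ℕ} (hd : 1 ≤ d)
    (a : EuclideanSpace ℝ (Fin d)) (ha : ‖a‖ = 1)
    (μ : ℝ → EuclideanSpace ℝ (Fin d) → ℝ)
    (hμint : ∀ δ > 0, Integrable (μ δ))
    (ω : ℝ → ℝ) (hωc : ContinuousOn ω (Ici 0)) (hωm : MonotoneOn ω (Ici 0))
    (hω0 : ω 0 = 0) (hωpos : ∀ t ∈ Ici (0:ℝ), 0 ≤ ω t)
    (α : ℝ) (hα0 : 0 < α) (hα1 : α ≤ 1)
    -- ω is α-Hölder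
    (Kω : ℝ) (hωHolder : ∀ s ∈ Ici (0:ℝ), ∀ t ∈ Ici (0:ℝ), |ω s - ω t| ≤ Kω * |s - t| ^ α)
    -- u is C¹ with α-Hölder gradient
    (u : EuclideanSpace ℝ (Fin d) → ℝ) (hu_smooth : ContDiff ℝ 1 u)
    (Ku : ℝ) (huHolder : ∀ x y, ‖fderiv ℝ u x - fderiv ℝ u y‖ ≤ Ku * ‖x - y‖ ^ α)
    -- (i) L¹-bounded first moments
    (M : ℝ) (hmom_int : ∀ δ > 0, Integrable (fun z => |μ δ z| * ‖z‖))
    (hM : ∀ δ > 0, (∫ z, |μ δ z| * ‖z‖) < M)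
    -- (ii) convergence of moments
    (hconv : ∀ δ > 0, ‖(∫ z, μ δ z • z) - a‖ ≤ ω δ)
    -- (iii'') compact support
    (hsupp : ∀ δ > 0, Function.support (μ δ) ⊆ closedBall 0 δ) :
    ∀ x : EuclideanSpace ℝ (Fin d), ∃ C : ℝ, ∀ δ > 0,
      |(∫ z, (u (x + z) - u x) * μ δ z) - fderiv ℝ u x a| ≤ C * δ ^ α := by
  intro x
  set L := fderiv ℝ u x
  refine ⟨|Ku| * M + ‖L‖ * Kω, fun δ hδ => ?_⟩
  set R := fun z => u (x + z) - u x - L z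
  have hLz : Integrable (fun z => μ δ z • z) := by
    refine (hmom_int δ hδ).mono' ((hμint δ hδ).aestronglyMeasurable.smul
      aestronglyMeasurable_id) (.of_forall fun z => ?_)
    simp [norm_smul]
  have hRbound : ∀ z, ‖R z * μ δ z‖ ≤ |Ku| * δ ^ α * (|μ δ z| * ‖z‖) := by
    intro z
    by_cases hz : μ δ z = 0
    · simp [hz]
    · have hzδ : ‖z‖ ≤ δ := by simpa using hsupp δ hδ hz
      have hR := norm_taylor_remainder_le_of_holder_fderiv (hu_smooth.differentiable one_ne_zero)
        hα0.le huHolder x z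
      calc ‖R z * μ δ z‖ = ‖R z‖ * |μ δ z| := by rw [norm_mul, Real.norm_eq_abs (μ δ z)]
        _ ≤ (|Ku| * ‖z‖ ^ α * ‖z‖) * |μ δ z| := by gcongr
        _ ≤ (|Ku| * δ ^ α * ‖z‖) * |μ δ z| := by gcongr
        _ = _ := by ring
  have hRc : Continuous R := by
    have := hu_smooth.continuous
    fun_prop
  have hRint : Integrable (fun z => R z * μ δ z) :=
    ((hmom_int δ hδ).const_mul _).mono'
      (hRc.aestronglyMeasurable.mul (hμint δ hδ).aestronglyMeasurable) (.of_forall hRbound)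
  have hsplit : (∫ z, (u (x + z) - u x) * μ δ z)
      = (∫ z, R z * μ δ z) + L (∫ z, μ δ z • z) := by
    rw [← L.integral_comp_comm hLz, ← integral_add hRint (L.integrable_comp hLz)]
    congr 1 with z
    simp only [R, map_smul, smul_eq_mul]
    ring
  have hR : |∫ z, R z * μ δ z| ≤ |Ku| * δ ^ α * M := by
    calc |∫ z, R z * μ δ z| ≤ ∫ z, |Ku| * δ ^ α * (|μ δ z| * ‖z‖) :=
          norm_integral_le_of_norm_le ((hmom_int δ hδ).const_mul _) (.of_forall hRbound)
      _ = |Ku| * δ ^ α * ∫ z, |μ δ z| * ‖z‖ := integral_const_mul _ _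
      _ ≤ |Ku| * δ ^ α * M := by gcongr; exact (hM δ hδ).le
  have hω : ω δ ≤ Kω * δ ^ α := by
    have h := hωHolder δ hδ.le 0 self_mem_Ici
    rw [hω0, sub_zero, sub_zero, abs_of_pos hδ] at h
    exact (le_abs_self _).trans h
  have hL : |L ((∫ z, μ δ z • z) - a)| ≤ ‖L‖ * (Kω * δ ^ α) :=
    L.le_opNorm_of_le ((hconv δ hδ).trans hω)
  calc |(∫ z, (u (x + z) - u x) * μ δ z) - L a|
      = |(∫ z, R z * μ δ z) + L ((∫ z, μ δ z • z) - a)| := by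
        rw [hsplit, map_sub, add_sub_assoc]
    _ ≤ |Ku| * δ ^ α * M + ‖L‖ * (Kω * δ ^ α) := (abs_add_le _ _).trans (add_le_add hR hL)
    _ = (|Ku| * M + ‖L‖ * Kω) * δ ^ α := by ring
end

section
/- For every δ > 0, the kernel μ_δ(z) = ((d+β)/(r δ^{d+β})) θ(z/|z|) |z|^{β−1} 1_{B_δ(0)}(z) is integrable with support in closedBall(0,δ), its first moment satisfies ∫_{ℝ^d} μ_δ(z) z dz = a, and ∫_{ℝ^d} |μ_δ(z)| |z| dz ≤ ‖θ‖_{L^∞} σ(∂B_1(0)) / r, a bound independent of δ. -/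
open MeasureTheory Metric Set
open scoped ENNReal

section PolarCoordinates

variable {E F : Type*} [NormedAddCommGroup E] [NormedSpace ℝ E] [MeasurableSpace E]
  [BorelSpace E] [FiniteDimensional ℝ E] [NormedAddCommGroup F] [NormedSpace ℝ F]

/-- Polar coordinates for a product of a radial and an angular function. -/
theorem integral_radial_smul_angular [Nontrivial E] (ν : Measure E) [ν.IsAddHaarMeasure]
    (f : ℝ → ℝ) (h : E → F) :
    ∫ x, f ‖x‖ • h (‖x‖⁻¹ • x) ∂ν =
      (∫ y in Ioi (0 : ℝ), y ^ (Module.finrank ℝ E - 1) * f y) •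
        ∫ ω : sphere (0 : E) 1, h ω ∂ν.toSphere :=
  calc
    _ = ∫ x : ({0}ᶜ : Set E), f ‖x.1‖ • h (‖x.1‖⁻¹ • x.1) ∂(ν.comap (↑)) := by
      rw [integral_subtype_comap (measurableSet_singleton _).compl
        fun x ↦ f ‖x‖ • h (‖x‖⁻¹ • x), restrict_compl_singleton]
    _ = ∫ p, f p.2 • h p.1 ∂ν.toSphere.prod (.volumeIoiPow (Module.finrank ℝ E - 1)) := by
      simpa using ν.measurePreserving_homeomorphUnitSphereProd.integral_comp
        (Homeomorph.measurableEmbedding _)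
        (fun p : sphere (0 : E) 1 × Ioi (0 : ℝ) ↦ f p.2 • h p.1)
    _ = (∫ y : Ioi (0 : ℝ), f y ∂.volumeIoiPow (Module.finrank ℝ E - 1)) •
          ∫ ω : sphere (0 : E) 1, h ω ∂ν.toSphere := by
      rw [← integral_prod_swap]
      exact integral_prod_smul (fun y : Ioi (0 : ℝ) ↦ f y) fun ω : sphere (0 : E) 1 ↦ h ω
    _ = _ := by
      congr 1
      simp only [Measure.volumeIoiPow, ENNReal.ofReal]
      rw [integral_withDensity_eq_integral_smul
          (measurable_subtype_coe.pow_const _).real_toNNReal,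
        integral_subtype_comap measurableSet_Ioi
          fun a ↦ Real.toNNReal (a ^ (Module.finrank ℝ E - 1)) • f a]
      refine setIntegral_congr_fun measurableSet_Ioi fun x hx ↦ ?_
      simp only [NNReal.smul_def, Real.coe_toNNReal _ (pow_nonneg (le_of_lt hx) _), smul_eq_mul]

end PolarCoordinates

theorem pow_mul_truncated_rpow_eqOn {n : ℕ} (hn : 1 ≤ n) (s δ : ℝ) :
    EqOn (fun y : ℝ ↦ y ^ (n - 1) * (Iio δ).indicator (fun y ↦ y ^ s) y)
      ((Iio δ).indicator fun y ↦ y ^ ((n : ℝ) + s - 1)) (Ioi 0) := by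
  intro y hy
  by_cases h : y ∈ Iio δ
  · simp only [indicator_of_mem h]
    rw [← Real.rpow_natCast, ← Real.rpow_add hy, Nat.cast_sub hn]
    congr 1
    push_cast
    ring
  · simp [indicator_of_notMem h]

theorem integrableOn_pow_mul_truncated_rpow {n : ℕ} (hn : 1 ≤ n) {s δ : ℝ} (hδ : 0 < δ)
    (hs : 0 < (n : ℝ) + s) :
    IntegrableOn (fun y : ℝ ↦ y ^ (n - 1) * (Iio δ).indicator (fun y ↦ y ^ s) y) (Ioi 0) := by
  rw [integrableOn_congr_fun (pow_mul_truncated_rpow_eqOn hn s δ) measurableSet_Ioi,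
    IntegrableOn, integrable_indicator_iff measurableSet_Iio, IntegrableOn,
    Measure.restrict_restrict measurableSet_Iio, inter_comm, Ioi_inter_Iio]
  exact (intervalIntegral.integrableOn_Ioo_rpow_iff hδ).2 (by linarith)

theorem integral_pow_mul_truncated_rpow {n : ℕ} (hn : 1 ≤ n) {s δ : ℝ} (hδ : 0 < δ)
    (hs : 0 < (n : ℝ) + s) :
    ∫ y in Ioi (0 : ℝ), y ^ (n - 1) * (Iio δ).indicator (fun y ↦ y ^ s) y =
      δ ^ ((n : ℝ) + s) / (n + s) := by
  rw [setIntegral_congr_fun measurableSet_Ioi (pow_mul_truncated_rpow_eqOn hn s δ),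
    setIntegral_indicator measurableSet_Iio, Ioi_inter_Iio, ← integral_Ioc_eq_integral_Ioo,
    ← intervalIntegral.integral_of_le hδ.le, integral_rpow (Or.inl (by linarith))]
  simp [Real.zero_rpow hs.ne']

/-- The sign-changing potential-type kernel
`μ_δ(z) = ((d+β)/(r δ^{d+β})) θ(z/|z|) |z|^{β−1} 1_{B_δ(0)}(z)`, built from a bounded
measurable `θ` on the unit sphere whose first moment is `r a`, is integrable with support
in `closedBall 0 δ`, has first moment exactly `a`, and satisfies the `δ`-independent bound
`∫ |μ_δ(z)| |z| dz ≤ ‖θ‖_{L^∞} σ(∂B₁(0)) / r`. -/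
theorem sphere_kernel_family
    {d : ℕ} (hd : 1 ≤ d)
    (a : EuclideanSpace ℝ (Fin d)) (β : ℝ) (hβ : 1 - (d : ℝ) < β)
    (θ : EuclideanSpace ℝ (Fin d) → ℝ) (hθmeas : Measurable θ)
    (B : ℝ) (hB : ∀ ω ∈ sphere (0 : EuclideanSpace ℝ (Fin d)) 1, |θ ω| ≤ B)
    (r : ℝ) (hr : 0 < r)
    (hθmom : (∫ ω : sphere (0 : EuclideanSpace ℝ (Fin d)) 1,
        θ (ω : EuclideanSpace ℝ (Fin d)) • (ω : EuclideanSpace ℝ (Fin d))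
        ∂((volume : Measure (EuclideanSpace ℝ (Fin d))).toSphere)) = r • a)
    (δ : ℝ) (hδ : 0 < δ)
    (μ : EuclideanSpace ℝ (Fin d) → ℝ)
    (hμ : μ = fun z => (((d : ℝ) + β) / (r * δ ^ ((d : ℝ) + β))) *
        θ (‖z‖⁻¹ • z) * ‖z‖ ^ (β - 1) *
        (ball (0 : EuclideanSpace ℝ (Fin d)) δ).indicator (fun _ => (1:ℝ)) z) :
    Integrable μ ∧
      Function.support μ ⊆ closedBall 0 δ ∧
      (∫ z, μ z • z) = a ∧
      (∫ z, |μ z| * ‖z‖)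
        ≤ B * ((volume : Measure (EuclideanSpace ℝ (Fin d))).toSphere univ).toReal / r := by
  have : Nonempty (Fin d) := ⟨⟨0, hd⟩⟩
  have hdim : Module.finrank ℝ (EuclideanSpace ℝ (Fin d)) = d := by simp
  have hB0 : 0 ≤ B := by
    obtain ⟨ω, hω⟩ := (NormedSpace.sphere_nonempty (E := EuclideanSpace ℝ (Fin d))
      (x := 0) (r := 1)).2 zero_le_one
    exact (abs_nonneg _).trans (hB ω hω)
  have hdβ : 0 < (d : ℝ) + β := by linarith
  set c : ℝ := ((d : ℝ) + β) / (r * δ ^ ((d : ℝ) + β)) with hc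
  have hδp : 0 < δ ^ ((d : ℝ) + β) := Real.rpow_pos_of_pos hδ _
  have hc0 : 0 < c := by positivity
  have hcr : c * (δ ^ ((d : ℝ) + β) / (d + β)) = r⁻¹ := by
    rw [hc]; field_simp
  have hind (s : ℝ) (z : EuclideanSpace ℝ (Fin d)) :
      (Iio δ).indicator (fun y ↦ y ^ s) ‖z‖ =
        ‖z‖ ^ s * (ball (0 : EuclideanSpace ℝ (Fin d)) δ).indicator (fun _ => (1 : ℝ)) z := by
    simp [indicator]
  have hint {s : ℝ} (hs : 0 < (d : ℝ) + s) : Integrable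
      fun z : EuclideanSpace ℝ (Fin d) ↦ (Iio δ).indicator (fun y ↦ y ^ s) ‖z‖ := by
    refine (integrable_fun_norm_addHaar volume).2 ?_
    simpa only [hdim, smul_eq_mul] using integrableOn_pow_mul_truncated_rpow hd hδ hs
  have hθB {z : EuclideanSpace ℝ (Fin d)} (hz : z ≠ 0) : |θ (‖z‖⁻¹ • z)| ≤ B :=
    hB _ (by simp [norm_smul, hz])
  have hmeas : Measurable μ := by
    rw [hμ]
    exact ((measurable_const.mul (hθmeas.comp (measurable_norm.inv.smul measurable_id))).mul
      (measurable_norm.pow_const _)).mul (measurable_const.indicator measurableSet_ball)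
  have hbound {z : EuclideanSpace ℝ (Fin d)} (hz : z ≠ 0) :
      |μ z| ≤ B * c * (Iio δ).indicator (fun y ↦ y ^ (β - 1)) ‖z‖ := by
    have hi : 0 ≤ (Iio δ).indicator (fun y ↦ y ^ (β - 1)) ‖z‖ :=
      indicator_apply_nonneg fun _ ↦ Real.rpow_nonneg (norm_nonneg z) _
    have : μ z = θ (‖z‖⁻¹ • z) * (c * (Iio δ).indicator (fun y ↦ y ^ (β - 1)) ‖z‖) := by
      rw [hμ, hind]; ring
    rw [this, abs_mul, abs_of_nonneg (mul_nonneg hc0.le hi), mul_assoc]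
    exact mul_le_mul_of_nonneg_right (hθB hz) (mul_nonneg hc0.le hi)
  have hpow {z : EuclideanSpace ℝ (Fin d)} (hz : z ≠ 0) :
      (Iio δ).indicator (fun y ↦ y ^ (β - 1)) ‖z‖ * ‖z‖ =
        (Iio δ).indicator (fun y ↦ y ^ β) ‖z‖ := by
    have h : ‖z‖ ≠ 0 := norm_ne_zero_iff.2 hz
    rw [hind, hind, Real.rpow_sub_one h]
    field_simp
  have hne : ∀ᵐ z : EuclideanSpace ℝ (Fin d), z ≠ 0 := Measure.ae_ne volume 0
  refine ⟨?_, ?_, ?_, ?_⟩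
  · refine ((hint (s := β - 1) (by linarith)).const_mul (B * c)).mono'
      hmeas.aestronglyMeasurable ?_
    filter_upwards [hne] with z hz using hbound hz
  · intro z hz
    by_contra hzb
    have : z ∉ ball (0 : EuclideanSpace ℝ (Fin d)) δ := fun h ↦ hzb (ball_subset_closedBall h)
    exact hz (by simp [hμ, indicator_of_notMem this])
  · have hpolar (z : EuclideanSpace ℝ (Fin d)) : μ z • z =
        c • ((Iio δ).indicator (fun y ↦ y ^ β) ‖z‖ •
          (θ (‖z‖⁻¹ • z) • (‖z‖⁻¹ • z))) := by
      by_cases hz : z = 0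
      · simp [hz]
      have h : ‖z‖ ≠ 0 := norm_ne_zero_iff.2 hz
      rw [← hpow hz, hind, hμ]
      simp only [smul_smul]
      congr 1
      field_simp
    simp_rw [hpolar]
    rw [integral_smul, integral_radial_smul_angular volume _ fun ω ↦ θ ω • ω, hdim,
      integral_pow_mul_truncated_rpow hd hδ hdβ, hθmom, smul_smul, smul_smul, hcr,
      inv_mul_cancel₀ hr.ne', one_smul]
  · calc
      ∫ z, |μ z| * ‖z‖ ≤ ∫ z : EuclideanSpace ℝ (Fin d),
          B * c * (Iio δ).indicator (fun y ↦ y ^ β) ‖z‖ := by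
        refine integral_mono_of_nonneg (.of_forall fun z ↦ by positivity)
          ((hint hdβ).const_mul _) ?_
        filter_upwards [hne] with z hz
        rw [← hpow hz, ← mul_assoc]
        exact mul_le_mul_of_nonneg_right (hbound hz) (norm_nonneg z)
      _ = _ := by
        have := integral_radial_smul_angular (volume : Measure (EuclideanSpace ℝ (Fin d)))
          ((Iio δ).indicator fun y ↦ y ^ β) fun _ ↦ (1 : ℝ)
        rw [hdim, integral_pow_mul_truncated_rpow hd hδ hdβ, integral_const] at this
        simp only [smul_eq_mul, mul_one] at this
        rw [integral_const_mul, this, measureReal_def, mul_assoc B, ← mul_assoc c, hcr]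
        ring
end

section
/- Let δ > 0, let μ_δ(z) = δ^{−2} sign(z) 1_{(−δ,δ)}(z), and let h : ℝ → ℝ be h(x) = sin(2πx/δ). Then for every x ∈ ℝ, D_δ h(x) = ∫_{ℝ} [h(x+z) − h(x)] μ_δ(z) dz = 0; that is, the nonlocal derivative of h with this kernel is identically zero. -/
open MeasureTheory Real Set

/-- Multiplying a `δ`-periodic function by the antisymmetric sign kernel on `(-δ, δ)` gives the
difference of its restriction to `(0, δ)` and the translate of that restriction to `(-δ, 0)`. -/
lemma mul_sign_mul_indicator_eq_sub {δ : ℝ} {f : ℝ → ℝ} (hf : Function.Periodic f δ) (z : ℝ) :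
    f z * (Real.sign z * (Ioo (-δ) δ).indicator (fun _ => (1 : ℝ)) z) =
      (Ioo 0 δ).indicator f z - (Ioo 0 δ).indicator f (z + δ) := by
  simp only [indicator_apply, mem_Ioo, hf z]
  rcases lt_trichotomy z 0 with hz | rfl | hz
  · rw [Real.sign_of_neg hz]
    split_ifs <;> first | (exfalso; grind) | simp
  · simp
  · rw [Real.sign_of_pos hz]
    split_ifs <;> first | (exfalso; grind) | simp

lemma integral_mul_sign_mul_indicator_eq_zero {δ : ℝ} {f : ℝ → ℝ} (hf : Function.Periodic f δ)
    (hc : Continuous f) :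
    ∫ z : ℝ, f z * (Real.sign z * (Ioo (-δ) δ).indicator (fun _ => (1 : ℝ)) z) = 0 := by
  have hg : Integrable ((Ioo 0 δ).indicator f) :=
    (hc.integrableOn_Icc.mono_set Ioo_subset_Icc_self).integrable_indicator measurableSet_Ioo
  simp_rw [mul_sign_mul_indicator_eq_sub hf]
  rw [integral_sub hg (hg.comp_add_right δ), integral_add_right_eq_self, sub_self]

/-- For the antisymmetric piecewise constant kernel
`μ_δ(z) = δ⁻² sign(z) 1_{(−δ,δ)}(z)` and `h(x) = sin(2πx/δ)`, the nonlocal derivative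
`D_δ h(x) = ∫ [h(x+z) − h(x)] μ_δ(z) dz` vanishes identically. -/
theorem nonlocal_derivative_of_resonant_sine_is_zero
    (δ : ℝ) (hδ : 0 < δ)
    (μ : ℝ → ℝ) (hμ : μ = fun z => δ⁻¹ ^ 2 * Real.sign z * (Set.Ioo (-δ) δ).indicator (fun _ => (1:ℝ)) z)
    (h : ℝ → ℝ) (hh : h = fun x => Real.sin (2 * Real.pi * x / δ)) :
    ∀ x : ℝ, ∫ z : ℝ, (h (x + z) - h x) * μ z = 0 := by
  subst hμ hh
  intro x
  have hp : Function.Periodic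
      (fun z => (Real.sin (2 * Real.pi * (x + z) / δ) - Real.sin (2 * Real.pi * x / δ)) * δ⁻¹ ^ 2)
      δ := by
    intro z
    have hz : 2 * Real.pi * (x + (z + δ)) / δ = 2 * Real.pi * (x + z) / δ + 2 * Real.pi := by
      field_simp
      ring
    simp only [hz, Real.sin_add_two_pi]
  simpa only [mul_assoc] using integral_mul_sign_mul_indicator_eq_zero hp (by fun_prop)
end

section
/- Let δ > 0 and define the one-sided kernel μ_δ(z) = (3/(2 δ^{3/2})) z^{−1/2} 1_{(0,δ)}(z) on ℝ. Then: (1) ∫_ℝ |μ_δ(z)| dz = 3/δ; (2) ∫_ℝ z μ_δ(z) dz = 1 = ∫_ℝ |z μ_δ(z)| dz; (3) the symmetric part μ_s(z) = (μ_δ(z) + μ_δ(−z))/2 satisfies ‖μ_s‖_{L^1(ℝ)} = 3/δ and ∫_{−δ}^{δ} z² μ_s(z) dz = (3/5) δ (so the second moment of the symmetric part tends to 0 as δ → 0⁺ even though ‖μ_s‖_{L^1} → ∞). -/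
open MeasureTheory Real Set

/-- The truncated power `z ↦ z ^ s` on `(0, δ)` has integral `δ ^ (s + 1) / (s + 1)`. -/
lemma integrable_and_integral_indicator_rpow {δ s : ℝ} (hδ : 0 < δ) (hs : -1 < s) :
    Integrable ((Set.Ioo (0:ℝ) δ).indicator fun z => z ^ s) ∧
      ∫ z, (Set.Ioo (0:ℝ) δ).indicator (fun z => z ^ s) z = δ ^ (s + 1) / (s + 1) := by
  constructor
  · rw [integrable_indicator_iff measurableSet_Ioo,
      ← intervalIntegrable_iff_integrableOn_Ioo_of_le hδ.le]
    exact intervalIntegral.intervalIntegrable_rpow' hs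
  · rw [integral_indicator measurableSet_Ioo, ← integral_Ioc_eq_integral_Ioo,
      ← intervalIntegral.integral_of_le hδ.le, integral_rpow (Or.inl hs),
      Real.zero_rpow (by linarith), sub_zero]

/-- The `n`-th moment of the one-sided kernel. -/
lemma integrable_and_integral_pow_mul_kernel {δ : ℝ} (hδ : 0 < δ) (n : ℕ) {μ : ℝ → ℝ}
    (hμ : μ = fun z => (3 / (2 * δ ^ ((3:ℝ)/2))) *
      (Set.Ioo (0:ℝ) δ).indicator (fun z => z ^ (-(1:ℝ)/2)) z) :
    Integrable (fun z => z ^ n * μ z) ∧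
      ∫ z, z ^ n * μ z = 3 / (2 * n + 1) * (δ ^ n / δ) := by
  have hn : (0:ℝ) ≤ n := n.cast_nonneg
  obtain ⟨hint, hval⟩ := integrable_and_integral_indicator_rpow (s := n + -(1:ℝ)/2) hδ
    (by linarith)
  have heq : (fun z => z ^ n * μ z) = fun z => (3 / (2 * δ ^ ((3:ℝ)/2))) *
      (Set.Ioo (0:ℝ) δ).indicator (fun z => z ^ ((n:ℝ) + -(1:ℝ)/2)) z := by
    funext z
    by_cases hz : z ∈ Set.Ioo 0 δ
    · simp only [hμ, Set.indicator_of_mem hz]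
      rw [Real.rpow_add hz.1, Real.rpow_natCast]
      ring
    · simp [hμ, Set.indicator_of_notMem hz]
  have hpow : δ ^ ((n:ℝ) + -(1:ℝ)/2 + 1) = δ ^ n / δ * δ ^ ((3:ℝ)/2) := by
    rw [show (n:ℝ) + -(1:ℝ)/2 + 1 = n - 1 + 3/2 by ring, Real.rpow_add hδ,
      Real.rpow_sub_one hδ.ne', Real.rpow_natCast]
  rw [heq]
  refine ⟨hint.const_mul _, ?_⟩
  rw [integral_const_mul, hval, hpow,
    show (n:ℝ) + -(1:ℝ)/2 + 1 = (2 * n + 1) / 2 by ring]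
  have hd : δ ^ ((3:ℝ)/2) ≠ 0 := (Real.rpow_pos_of_pos hδ _).ne'
  field_simp

/-- For the one-sided kernel `μ_δ(z) = (3/(2δ^{3/2})) z^{−1/2} 1_{(0,δ)}(z)`:
(1) `∫|μ_δ| = 3/δ`; (2) `∫ z μ_δ(z) dz = 1 = ∫ |z μ_δ(z)| dz`; (3) the symmetric part
`μ_s(z) = (μ_δ(z)+μ_δ(−z))/2` satisfies `‖μ_s‖_{L¹} = 3/δ` and
`∫_{−δ}^{δ} z² μ_s(z) dz = (3/5)δ`. -/
theorem one_sided_kernel_moments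
    (δ : ℝ) (hδ : 0 < δ)
    (μ : ℝ → ℝ)
    (hμ : μ = fun z => (3 / (2 * δ ^ ((3:ℝ)/2))) * (Set.Ioo (0:ℝ) δ).indicator (fun z => z ^ (-(1:ℝ)/2)) z)
    (μs : ℝ → ℝ) (hμs : μs = fun z => (μ z + μ (-z)) / 2) :
    (∫ z : ℝ, |μ z|) = 3 / δ
      ∧ (∫ z : ℝ, z * μ z) = 1
      ∧ (∫ z : ℝ, |z * μ z|) = 1
      ∧ (∫ z : ℝ, |μs z|) = 3 / δ
      ∧ (∫ z in (-δ)..δ, z ^ 2 * μs z) = (3 / 5) * δ := by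
  have hnonneg : ∀ z, 0 ≤ μ z := by
    intro z
    rw [hμ]
    exact mul_nonneg (by positivity)
      (Set.indicator_nonneg (fun z hz => Real.rpow_nonneg hz.1.le _) z)
  have hzero : ∀ z, z ∉ Set.Ioo 0 δ → μ z = 0 := by
    intro z hz
    simp [hμ, Set.indicator_of_notMem hz]
  have hnonneg' : ∀ z, 0 ≤ z * μ z := by
    intro z
    by_cases hz : z ∈ Set.Ioo 0 δ
    · exact mul_nonneg hz.1.le (hnonneg z)
    · simp [hzero z hz]
  have hsnonneg : ∀ z, 0 ≤ μs z := by
    intro z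
    rw [hμs]
    exact div_nonneg (add_nonneg (hnonneg z) (hnonneg (-z))) zero_le_two
  obtain ⟨hint₀, hval₀⟩ := integrable_and_integral_pow_mul_kernel hδ 0 hμ
  obtain ⟨-, hval₁⟩ := integrable_and_integral_pow_mul_kernel hδ 1 hμ
  obtain ⟨hint₂, hval₂⟩ := integrable_and_integral_pow_mul_kernel hδ 2 hμ
  have hsymm : ∀ f : ℝ → ℝ, Integrable f → ∫ z, (f z + f (-z)) / 2 = ∫ z, f z := by
    intro f hf
    rw [integral_div, integral_add hf hf.comp_neg, integral_neg_eq_self]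
    ring
  have h₀ : ∫ z, μ z = 3 / δ := by
    simpa [div_eq_mul_inv] using hval₀
  have h₁ : ∫ z, z * μ z = 1 := by
    have hone : (3:ℝ) / (2 * (1:ℕ) + 1) * (δ ^ 1 / δ) = 1 := by
      rw [pow_one, div_self hδ.ne']
      norm_num
    simpa only [pow_one] using hval₁.trans hone
  simp only [abs_of_nonneg (hnonneg _), abs_of_nonneg (hnonneg' _), abs_of_nonneg (hsnonneg _)]
  refine ⟨h₀, h₁, h₁, ?_, ?_⟩
  · rw [hμs, hsymm μ (by simpa using hint₀), h₀]
  · rw [intervalIntegral.integral_eq_integral_of_support_subset]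
    · have heq : (fun z => z ^ 2 * μs z) =
          fun z => (z ^ 2 * μ z + (-z) ^ 2 * μ (-z)) / 2 := by
        funext z
        rw [hμs]
        ring
      rw [heq, hsymm (fun z => z ^ 2 * μ z) hint₂, hval₂]
      field_simp
      norm_num
    · intro z hz
      by_contra hmem
      refine hz ?_
      have hpos : μ z = 0 := hzero z fun h => hmem ⟨by linarith [h.1], h.2.le⟩
      have hneg : μ (-z) = 0 :=
        hzero (-z) fun h => hmem ⟨by linarith [h.2], by linarith [h.1]⟩
      simp [hμs, hpos, hneg]
end

section
/- Let p ∈ [1,∞) and let μ_δ ∈ L^1(ℝ^d) have support contained in closedBall(0,δ). Then the cross-correlation operator S : L^p(Ω_δ) → L^p(Ω) defined by S u(x) = ∫_{Ω_δ} u(y) μ_δ(y−x) dy is a compact linear operator. -/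
open MeasureTheory Metric Set
open scoped ENNReal

theorem ENNReal.lintegral_mul_rpow_le_lintegral_rpow_mul {α : Type*} [MeasurableSpace α]
    {ν : Measure α} {a w : α → ℝ≥0∞} (ha : AEMeasurable a ν) (hw : AEMeasurable w ν)
    {q : ℝ} (hq : 1 ≤ q) :
    (∫⁻ y, a y * w y ∂ν) ^ q ≤ (∫⁻ y, a y ^ q * w y ∂ν) * (∫⁻ y, w y ∂ν) ^ (q - 1) := by
  have hq0 : 0 < q := by linarith
  have h1 : 0 ≤ 1 - q⁻¹ := sub_nonneg.2 (inv_le_one_of_one_le₀ hq)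
  have h2 : 0 ≤ q⁻¹ := inv_nonneg.2 hq0.le
  have h := ENNReal.lintegral_mul_norm_pow_le (μ := ν) (f := fun y => a y ^ q * w y) (g := w)
    (by fun_prop) hw h2 h1 (by ring)
  have heq : ∀ y, (a y ^ q * w y) ^ q⁻¹ * w y ^ (1 - q⁻¹) = a y * w y := fun y => by
    rw [ENNReal.mul_rpow_of_nonneg _ _ h2, ENNReal.rpow_rpow_inv hq0.ne', mul_assoc,
      ← ENNReal.rpow_add_of_nonneg _ _ h2 h1, add_sub_cancel, ENNReal.rpow_one]
  simp_rw [heq] at h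
  refine (ENNReal.rpow_le_rpow h hq0.le).trans_eq ?_
  rw [ENNReal.mul_rpow_of_nonneg _ _ hq0.le, ENNReal.rpow_inv_rpow hq0.ne', ← ENNReal.rpow_mul]
  congr 2
  field_simp

section CrossCorrelation

variable {E : Type*} [NormedAddCommGroup E] [NormedSpace ℝ E] [FiniteDimensional ℝ E]
  [MeasurableSpace E] [BorelSpace E] {m : Measure E} [m.IsAddHaarMeasure]

theorem aestronglyMeasurable_comp_snd_sub_fst (A : Set E) {k : E → ℝ}
    (hk : AEStronglyMeasurable k m) :
    AEStronglyMeasurable (fun z : E × E => k (z.2 - z.1)) (m.prod (m.restrict A)) := by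
  have h : AEStronglyMeasurable (fun z : E × E => k (z.1 - z.2)) (m.prod m) :=
    hk.comp_quasiMeasurePreserving (quasiMeasurePreserving_sub m m)
  exact h.prod_swap.mono_ac (Measure.AbsolutelyContinuous.rfl.prod
    Measure.restrict_le_self.absolutelyContinuous)

theorem lintegral_lintegral_mul_sub_rpow_le (A : Set E) {u k : E → ℝ}
    (hu : AEStronglyMeasurable u (m.restrict A)) (hk : AEStronglyMeasurable k m)
    {q : ℝ} (hq : 1 ≤ q) :
    ∫⁻ x, (∫⁻ y in A, ‖u y‖ₑ * ‖k (y - x)‖ₑ ∂m) ^ q ∂m ≤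
      (∫⁻ y in A, ‖u y‖ₑ ^ q ∂m) * (∫⁻ y, ‖k y‖ₑ ∂m) ^ q := by
  set W := ∫⁻ y, ‖k y‖ₑ ∂m
  have hkx (x : E) : AEMeasurable (fun y => ‖k (y - x)‖ₑ) (m.restrict A) :=
    (hk.comp_quasiMeasurePreserving
      (measurePreserving_sub_right m x).quasiMeasurePreserving).enorm.restrict
  have hjoint : AEMeasurable (fun z : E × E => ‖u z.2‖ₑ ^ q * ‖k (z.2 - z.1)‖ₑ)
      (m.prod (m.restrict A)) :=
    (hu.comp_snd.enorm.pow_const q).mul (aestronglyMeasurable_comp_snd_sub_fst A hk).enorm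
  calc
    _ ≤ ∫⁻ x, (∫⁻ y in A, ‖u y‖ₑ ^ q * ‖k (y - x)‖ₑ ∂m) * W ^ (q - 1) ∂m := by
      refine lintegral_mono fun x => ?_
      refine (ENNReal.lintegral_mul_rpow_le_lintegral_rpow_mul hu.enorm (hkx x) hq).trans ?_
      refine mul_le_mul_right (ENNReal.rpow_le_rpow ?_ (sub_nonneg.2 hq)) _
      exact (setLIntegral_le_lintegral A _).trans_eq
        (lintegral_sub_right_eq_self (fun y => ‖k y‖ₑ) x)
    _ = (∫⁻ x, ∫⁻ y in A, ‖u y‖ₑ ^ q * ‖k (y - x)‖ₑ ∂m ∂m) * W ^ (q - 1) :=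
      lintegral_mul_const'' _ hjoint.lintegral_prod_right'
    _ = (∫⁻ y in A, ∫⁻ x, ‖u y‖ₑ ^ q * ‖k (y - x)‖ₑ ∂m ∂m) * W ^ (q - 1) := by
      rw [lintegral_lintegral_swap hjoint]
    _ = (∫⁻ y in A, ‖u y‖ₑ ^ q * W ∂m) * W ^ (q - 1) := by
      congr 2 with y
      have hky : AEMeasurable (fun x => ‖k (y - x)‖ₑ) m := (hk.comp_quasiMeasurePreserving
        (quasiMeasurePreserving_sub_left_of_right_invariant m y)).enorm
      rw [lintegral_const_mul'' _ hky, lintegral_sub_left_eq_self (fun x => ‖k x‖ₑ)]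
    _ = _ := by
      rw [lintegral_mul_const'' _ (hu.enorm.pow_const q), mul_assoc]
      congr 1
      nth_rw 1 [← ENNReal.rpow_one W]
      rw [← ENNReal.rpow_add_of_nonneg _ _ zero_le_one (by linarith), add_sub_cancel]

theorem ae_integrable_mul_comp_sub (A : Set E) {u k : E → ℝ} {p : ℝ≥0∞} (hp : 1 ≤ p) (hpt : p ≠ ∞)
    (hu : MemLp u p (m.restrict A)) (hk : Integrable k m) :
    ∀ᵐ x ∂m, Integrable (fun y => u y * k (y - x)) (m.restrict A) := by
  have hq : 1 ≤ p.toReal := by simpa using ENNReal.toReal_mono hpt hp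
  have hle := lintegral_lintegral_mul_sub_rpow_le A hu.1 hk.1 hq
  have hfin : (∫⁻ y in A, ‖u y‖ₑ ^ p.toReal ∂m) * (∫⁻ y, ‖k y‖ₑ ∂m) ^ p.toReal < ∞ :=
    ENNReal.mul_lt_top
      ((eLpNorm_lt_top_iff_lintegral_rpow_enorm_lt_top (by positivity) hpt).1 hu.2)
      (ENNReal.rpow_lt_top_of_nonneg (by positivity) hk.2.ne)
  have hmeas : AEMeasurable (fun x => (∫⁻ y in A, ‖u y‖ₑ * ‖k (y - x)‖ₑ ∂m) ^ p.toReal) m := by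
    refine AEMeasurable.pow_const ?_ _
    exact (hu.1.comp_snd.enorm.mul
      (aestronglyMeasurable_comp_snd_sub_fst A hk.1).enorm).lintegral_prod_right'
  filter_upwards [ae_lt_top' hmeas (hle.trans_lt hfin).ne] with x hx
  refine ⟨hu.1.mul (hk.1.comp_quasiMeasurePreserving
      (measurePreserving_sub_right m x).quasiMeasurePreserving).restrict, ?_⟩
  simp only [HasFiniteIntegral, enorm_mul]
  by_contra h
  rw [not_lt, top_le_iff] at h
  simp [h, ENNReal.top_rpow_of_pos (zero_lt_one.trans_le hq)] at hx

theorem eLpNorm_integral_mul_comp_sub_le (A : Set E) {u k : E → ℝ} {p : ℝ≥0∞} (hp : 1 ≤ p)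
    (hpt : p ≠ ∞) (hu : AEStronglyMeasurable u (m.restrict A)) (hk : AEStronglyMeasurable k m) :
    eLpNorm (fun x => ∫ y in A, u y * k (y - x) ∂m) p m ≤
      eLpNorm k 1 m * eLpNorm u p (m.restrict A) := by
  have hq : 1 ≤ p.toReal := by simpa using ENNReal.toReal_mono hpt hp
  have hq0 : 0 < p.toReal := by linarith
  have hp0 : p ≠ 0 := by positivity
  rw [eLpNorm_eq_lintegral_rpow_enorm_toReal hp0 hpt, eLpNorm_eq_lintegral_rpow_enorm_toReal hp0 hpt,
    eLpNorm_one_eq_lintegral_enorm, one_div]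
  calc
    _ ≤ (∫⁻ x, (∫⁻ y in A, ‖u y‖ₑ * ‖k (y - x)‖ₑ ∂m) ^ p.toReal ∂m) ^ p.toReal⁻¹ := by
      gcongr with x
      refine (enorm_integral_le_lintegral_enorm _).trans_eq ?_
      simp_rw [enorm_mul]
    _ ≤ _ := ENNReal.rpow_le_rpow (lintegral_lintegral_mul_sub_rpow_le A hu hk hq) (by positivity)
    _ = _ := by
      rw [ENNReal.mul_rpow_of_nonneg _ _ (by positivity), ENNReal.rpow_rpow_inv hq0.ne', mul_comm]

/-- Young's inequality in operator form. -/
theorem exists_crossCorrelation (A B : Set E) {k : E → ℝ} (hk : Integrable k m) {p : ℝ≥0∞}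
    [Fact (1 ≤ p)] (hpt : p ≠ ∞) :
    ∃ T : Lp ℝ p (m.restrict A) →L[ℝ] Lp ℝ p (m.restrict B),
      (∀ u : Lp ℝ p (m.restrict A),
        T u =ᵐ[m.restrict B] fun x => ∫ y in A, u y * k (y - x) ∂m) ∧
      ‖T‖ ≤ ∫ x, ‖k x‖ ∂m := by
  have hp : 1 ≤ p := Fact.out
  have hle (u : Lp ℝ p (m.restrict A)) :
      eLpNorm (fun x => ∫ y in A, u y * k (y - x) ∂m) p (m.restrict B) ≤
        eLpNorm k 1 m * eLpNorm u p (m.restrict A) :=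
    (eLpNorm_mono_measure _ Measure.restrict_le_self).trans
      (eLpNorm_integral_mul_comp_sub_le A hp hpt (Lp.aestronglyMeasurable u) hk.1)
  have hfin (u : Lp ℝ p (m.restrict A)) : eLpNorm k 1 m * eLpNorm u p (m.restrict A) < ∞ :=
    ENNReal.mul_lt_top (memLp_one_iff_integrable.2 hk).2 (Lp.memLp u).2
  have hmem (u : Lp ℝ p (m.restrict A)) :
      MemLp (fun x => ∫ y in A, u y * k (y - x) ∂m) p (m.restrict B) :=
    ⟨((Lp.aestronglyMeasurable u).comp_snd.mul
      (aestronglyMeasurable_comp_snd_sub_fst A hk.1)).integral_prod_right'.restrict,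
      (hle u).trans_lt (hfin u)⟩
  have hint (u : Lp ℝ p (m.restrict A)) :
      ∀ᵐ x ∂m.restrict B, Integrable (fun y => u y * k (y - x)) (m.restrict A) :=
    ae_restrict_of_ae (ae_integrable_mul_comp_sub A hp hpt (Lp.memLp u) hk)
  let L : Lp ℝ p (m.restrict A) →ₗ[ℝ] Lp ℝ p (m.restrict B) :=
    { toFun := fun u => (hmem u).toLp _
      map_add' := fun u v => by
        rw [← MemLp.toLp_add, MemLp.toLp_eq_toLp_iff]
        filter_upwards [hint u, hint v] with x hx hx'
        rw [Pi.add_apply, ← integral_add hx hx']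
        refine integral_congr_ae ?_
        filter_upwards [Lp.coeFn_add u v] with y hy
        rw [hy, Pi.add_apply, add_mul]
      map_smul' := fun c u => by
        rw [RingHom.id_apply, ← MemLp.toLp_const_smul, MemLp.toLp_eq_toLp_iff]
        refine Filter.Eventually.of_forall fun x => ?_
        simp only [Pi.smul_apply]
        rw [← integral_smul]
        refine integral_congr_ae ?_
        filter_upwards [Lp.coeFn_smul c u] with y hy
        rw [hy, Pi.smul_apply, smul_eq_mul, smul_eq_mul, mul_assoc] }
  refine ⟨L.mkContinuous (∫ x, ‖k x‖ ∂m) fun u => ?_, fun u => (hmem u).coeFn_toLp,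
    L.mkContinuous_norm_le (by positivity) _⟩
  change ‖(hmem u).toLp _‖ ≤ _
  rw [Lp.norm_toLp, integral_norm_eq_lintegral_enorm hk.1, ← eLpNorm_one_eq_lintegral_enorm,
    Lp.norm_def, ← ENNReal.toReal_mul]
  exact ENNReal.toReal_mono (hfin u).ne (hle u)

end CrossCorrelation

section Approximation

variable {X F : Type*} [MeasurableSpace X] {m : Measure X} [IsFiniteMeasure m]
  [NormedAddCommGroup F] [NormedSpace ℝ F] {p : ℝ≥0∞} [Fact (1 ≤ p)]

theorem MeasureTheory.SimpleFunc.exists_isCompactOperator_toLp (s : SimpleFunc X (F →L[ℝ] ℝ)) :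
    ∃ S : F →L[ℝ] Lp ℝ p m, IsCompactOperator S ∧ ∀ f, S f =ᵐ[m] fun x => s x f := by
  induction s using SimpleFunc.induction with
  | const φ hs =>
    rename_i s
    refine ⟨(ContinuousLinearMap.toSpanSingleton ℝ
      (indicatorConstLp p hs (measure_ne_top m s) (1 : ℝ))).comp φ, ?_, fun f => ?_⟩
    · have hφ : IsCompactOperator φ := isCompactOperator_of_locallyCompactSpace_dom φ
      exact hφ.clm_comp (ContinuousLinearMap.toSpanSingleton ℝ
        (indicatorConstLp p hs (measure_ne_top m s) (1 : ℝ)))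
    · have h1 : φ f • indicatorConstLp p hs (measure_ne_top m s) (1 : ℝ) =ᵐ[m] _ :=
        Lp.coeFn_smul _ _
      filter_upwards [h1, indicatorConstLp_coeFn (p := p) (hs := hs)
        (hμs := measure_ne_top m s) (c := (1 : ℝ))] with x hx hx'
      simp only [ContinuousLinearMap.comp_apply, ContinuousLinearMap.toSpanSingleton_apply]
      rw [hx, Pi.smul_apply, hx']
      by_cases hxs : x ∈ s <;> simp [hxs]
  | add _ hs ht =>
    obtain ⟨S, hS, hSf⟩ := hs
    obtain ⟨T, hT, hTf⟩ := ht
    refine ⟨S + T, hS.add hT, fun f => ?_⟩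
    filter_upwards [hSf f, hTf f, Lp.coeFn_add (S f) (T f)] with x h1 h2 h3
    rw [_root_.add_apply, h3, Pi.add_apply, h1, h2, SimpleFunc.coe_add, Pi.add_apply,
      _root_.add_apply]

theorem isCompactOperator_of_forall_exists_simpleFunc {Φ : X → F →L[ℝ] ℝ} {T : F →L[ℝ] Lp ℝ p m}
    (hT : ∀ f, T f =ᵐ[m] fun x => Φ x f)
    (hΦ : ∀ ε > 0, ∃ s : SimpleFunc X (F →L[ℝ] ℝ), ∀ᵐ x ∂m, ‖Φ x - s x‖ ≤ ε) :
    IsCompactOperator T := by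
  set C : ℝ := (measureUnivNNReal m : ℝ) ^ p.toReal⁻¹ with hC
  have hC0 : 0 ≤ C := by positivity
  have hcl : T ∈ closure {S : F →L[ℝ] Lp ℝ p m | IsCompactOperator S} := by
    refine Metric.mem_closure_iff.2 fun ε hε => ?_
    obtain ⟨s, hs⟩ := hΦ (ε / (2 * (C + 1))) (by positivity)
    obtain ⟨S, hS, hSf⟩ := s.exists_isCompactOperator_toLp (m := m) (p := p)
    refine ⟨S, hS, ?_⟩
    rw [dist_eq_norm]
    refine (ContinuousLinearMap.opNorm_le_bound _ (half_pos hε).le fun f => ?_).trans_lt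
      (half_lt_self hε)
    have hb : ∀ᵐ x ∂m, ‖(T f - S f : Lp ℝ p m) x‖ ≤ ε / (2 * (C + 1)) * ‖f‖ := by
      filter_upwards [hs, hT f, hSf f, Lp.coeFn_sub (T f) (S f)] with x h1 h2 h3 h4
      rw [h4, Pi.sub_apply, h2, h3, ← sub_apply]
      exact ContinuousLinearMap.le_of_opNorm_le _ h1 f
    refine (Lp.norm_le_of_ae_bound (by positivity) hb).trans ?_
    rw [← mul_assoc]
    gcongr
    rw [← hC, mul_div_assoc', div_le_div_iff₀ (by positivity) two_pos]
    nlinarith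
  rwa [isClosed_setOfPred_isCompactOperator.closure_eq] at hcl

end Approximation

section Functional

variable {X : Type*} [MeasurableSpace X] {ν : Measure X} [IsFiniteMeasure ν] {p : ℝ≥0∞}
  [Fact (1 ≤ p)]

theorem integrable_Lp_mul_of_bound {g : X → ℝ} (hg : AEStronglyMeasurable g ν) {M : ℝ}
    (hM : ∀ y, ‖g y‖ ≤ M) (f : Lp ℝ p ν) : Integrable (fun y => f y * g y) ν :=
  ((Lp.memLp f).integrable Fact.out).mul_bdd hg (Filter.Eventually.of_forall hM)

theorem exists_norm_integral_Lp_mul_le :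
    ∃ C : ℝ, 0 ≤ C ∧ ∀ (f : Lp ℝ p ν) (g : X → ℝ) (M : ℝ), 0 ≤ M → (∀ y, ‖g y‖ ≤ M) →
      ‖∫ y, f y * g y ∂ν‖ ≤ C * M * ‖f‖ := by
  have hp : 1 ≤ p := Fact.out
  set C := ν univ ^ (1 / (1 : ℝ≥0∞).toReal - 1 / p.toReal)
  have hCtop : C ≠ ∞ := by
    refine ENNReal.rpow_ne_top_of_nonneg ?_ (measure_ne_top ν _)
    rcases eq_or_ne p ∞ with rfl | hpt
    · simp
    · have hq : 1 ≤ p.toReal := by simpa using ENNReal.toReal_mono hpt hp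
      simpa using inv_le_one_of_one_le₀ hq
  refine ⟨C.toReal, by positivity, fun f g M hM0 hM => ?_⟩
  have hf : ∫ y, ‖f y‖ ∂ν ≤ C.toReal * ‖f‖ := by
    rw [integral_norm_eq_lintegral_enorm (Lp.aestronglyMeasurable f),
      ← eLpNorm_one_eq_lintegral_enorm, Lp.norm_def, ← ENNReal.toReal_mul, mul_comm]
    exact ENNReal.toReal_mono (ENNReal.mul_ne_top (Lp.memLp f).2.ne hCtop)
      (eLpNorm_le_eLpNorm_mul_rpow_measure_univ hp (Lp.aestronglyMeasurable f))
  calc ‖∫ y, f y * g y ∂ν‖ ≤ ∫ y, ‖f y‖ * M ∂ν := by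
        refine norm_integral_le_of_norm_le (((Lp.memLp f).integrable hp).norm.mul_const M)
          (Filter.Eventually.of_forall fun y => ?_)
        rw [norm_mul]
        exact mul_le_mul_of_nonneg_left (hM y) (norm_nonneg _)
    _ = (∫ y, ‖f y‖ ∂ν) * M := integral_mul_const _ _
    _ ≤ C.toReal * ‖f‖ * M := by gcongr
    _ = C.toReal * M * ‖f‖ := by ring

theorem exists_clm_integral_Lp_mul {g : X → ℝ} (hg : AEStronglyMeasurable g ν) {M : ℝ}
    (hM0 : 0 ≤ M) (hM : ∀ y, ‖g y‖ ≤ M) :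
    ∃ φ : Lp ℝ p ν →L[ℝ] ℝ, ∀ f : Lp ℝ p ν, φ f = ∫ y, f y * g y ∂ν := by
  obtain ⟨C, -, hC⟩ := exists_norm_integral_Lp_mul_le (ν := ν) (p := p)
  have hint := integrable_Lp_mul_of_bound (p := p) hg hM
  let L : Lp ℝ p ν →ₗ[ℝ] ℝ :=
    { toFun := fun f => ∫ y, f y * g y ∂ν
      map_add' := fun u v => by
        rw [← integral_add (hint u) (hint v)]
        refine integral_congr_ae ?_
        filter_upwards [Lp.coeFn_add u v] with y hy
        rw [hy, Pi.add_apply, add_mul]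
      map_smul' := fun c u => by
        rw [RingHom.id_apply, ← integral_smul]
        refine integral_congr_ae ?_
        filter_upwards [Lp.coeFn_smul c u] with y hy
        rw [hy, Pi.smul_apply, smul_eq_mul, smul_eq_mul, mul_assoc] }
  exact ⟨L.mkContinuousOfExistsBound ⟨C * M, fun f => hC f g M hM0 hM⟩, fun f => rfl⟩

end Functional

theorem exists_simpleFunc_dist_lt_of_isBounded {E : Type*} [PseudoMetricSpace E] [ProperSpace E]
    [MeasurableSpace E] [OpensMeasurableSpace E] [Nonempty E] {B : Set E}
    (hB : Bornology.IsBounded B) {η : ℝ} (hη : 0 < η) :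
    ∃ s : SimpleFunc E E, ∀ x ∈ B, dist (s x) x < η := by
  have hcover : closure B ⊆ ⋃ n, ball (TopologicalSpace.denseSeq E n) η := fun x _ => by
    obtain ⟨n, hn⟩ := (TopologicalSpace.denseRange_denseSeq E).exists_dist_lt x hη
    exact mem_iUnion.2 ⟨n, hn⟩
  obtain ⟨t, ht⟩ := hB.isCompact_closure.elim_finite_subcover _ (fun _ => isOpen_ball) hcover
  refine ⟨SimpleFunc.nearestPt (TopologicalSpace.denseSeq E) (t.sup id), fun x hx => ?_⟩
  obtain ⟨n, hn, hxn⟩ := mem_iUnion₂.1 (ht (subset_closure hx))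
  have h := SimpleFunc.edist_nearestPt_le (TopologicalSpace.denseSeq E) x
    (Finset.le_sup (f := id) hn)
  rw [edist_dist, edist_dist, ENNReal.ofReal_le_ofReal_iff dist_nonneg] at h
  exact h.trans_lt (mem_ball'.1 hxn)

section Compactness

variable {E : Type*} [NormedAddCommGroup E] [NormedSpace ℝ E] [FiniteDimensional ℝ E]
  [MeasurableSpace E] [BorelSpace E] {m : Measure E} {A B : Set E} {p : ℝ≥0∞} [Fact (1 ≤ p)]

theorem isCompactOperator_of_continuous_kernel [IsFiniteMeasureOnCompacts m]
    (hA : Bornology.IsBounded A) (hB : Bornology.IsBounded B) (hBm : MeasurableSet B)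
    {k : E → ℝ} (hk : Continuous k) (hks : HasCompactSupport k)
    {T : Lp ℝ p (m.restrict A) →L[ℝ] Lp ℝ p (m.restrict B)}
    (hT : ∀ u : Lp ℝ p (m.restrict A),
      T u =ᵐ[m.restrict B] fun x => ∫ y in A, u y * k (y - x) ∂m) :
    IsCompactOperator T := by
  have : ProperSpace E := FiniteDimensional.proper ℝ E
  have : IsFiniteMeasure (m.restrict A) := ⟨by simpa using hA.measure_lt_top⟩
  have : IsFiniteMeasure (m.restrict B) := ⟨by simpa using hB.measure_lt_top⟩
  obtain ⟨M, hM⟩ := hk.bounded_above_of_compact_support hks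
  have hM0 : 0 ≤ M := (norm_nonneg _).trans (hM 0)
  have hkm (x : E) : AEStronglyMeasurable (fun y => k (y - x)) (m.restrict A) :=
    (by fun_prop : Continuous fun y => k (y - x)).aestronglyMeasurable
  choose Φ hΦ using fun x : E =>
    exists_clm_integral_Lp_mul (p := p) (hkm x) hM0 fun y => hM (y - x)
  refine isCompactOperator_of_forall_exists_simpleFunc (Φ := Φ)
    (fun f => (hT f).trans (.of_forall fun x => (hΦ x f).symm)) fun ε hε => ?_
  obtain ⟨C, hC0, hC⟩ := exists_norm_integral_Lp_mul_le (ν := m.restrict A) (p := p)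
  obtain ⟨η, hη, hkη⟩ := Metric.uniformContinuous_iff.1 (hks.uniformContinuous_of_continuous hk)
    (ε / (C + 1)) (by positivity)
  obtain ⟨s, hs⟩ := exists_simpleFunc_dist_lt_of_isBounded hB hη
  refine ⟨s.map Φ, (ae_restrict_iff' hBm).2 (.of_forall fun x hx => ?_)⟩
  have hle : C * (ε / (C + 1)) ≤ ε := by
    rw [mul_div_assoc', div_le_iff₀ (by positivity)]
    nlinarith
  refine (ContinuousLinearMap.opNorm_le_bound _ (by positivity) fun f => ?_).trans hle
  rw [sub_apply, SimpleFunc.map_apply, hΦ, hΦ,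
    ← integral_sub (integrable_Lp_mul_of_bound (hkm x) (fun y => hM (y - x)) f)
      (integrable_Lp_mul_of_bound (hkm (s x)) (fun y => hM (y - s x)) f)]
  simp_rw [← mul_sub]
  refine hC f (fun y => k (y - x) - k (y - s x)) _ (by positivity) fun y => ?_
  rw [← dist_eq_norm]
  refine (hkη ?_).le
  rw [dist_sub_left, dist_comm]
  exact hs x hx

theorem exists_isCompactOperator_crossCorrelation [m.IsAddHaarMeasure]
    (hA : Bornology.IsBounded A) (hB : Bornology.IsBounded B) (hBm : MeasurableSet B)
    (hpt : p ≠ ∞) {k : E → ℝ} (hk : Integrable k m) :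
    ∃ T : Lp ℝ p (m.restrict A) →L[ℝ] Lp ℝ p (m.restrict B), IsCompactOperator T ∧
      ∀ u : Lp ℝ p (m.restrict A),
        T u =ᵐ[m.restrict B] fun x => ∫ y in A, u y * k (y - x) ∂m := by
  have : ProperSpace E := FiniteDimensional.proper ℝ E
  have hp : 1 ≤ p := Fact.out
  obtain ⟨T, hT, -⟩ := exists_crossCorrelation A B hk (p := p) hpt
  refine ⟨T, ?_, hT⟩
  have hcl : T ∈ closure
      {S : Lp ℝ p (m.restrict A) →L[ℝ] Lp ℝ p (m.restrict B) | IsCompactOperator S} := by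
    refine Metric.mem_closure_iff.2 fun ε hε => ?_
    obtain ⟨g, hgs, hkg, hgc, hgi⟩ := hk.exists_hasCompactSupport_integral_sub_le (half_pos hε)
    obtain ⟨S, hS, -⟩ := exists_crossCorrelation A B hgi (p := p) hpt
    obtain ⟨R, hR, hRn⟩ := exists_crossCorrelation A B (hk.sub hgi) (p := p) hpt
    refine ⟨S, isCompactOperator_of_continuous_kernel hA hB hBm hgc hgs hS, ?_⟩
    have hTS : T - S = R := by
      ext1 u
      refine Lp.ext ?_
      filter_upwards [hT u, hS u, hR u, Lp.coeFn_sub (T u) (S u),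
        ae_restrict_of_ae (ae_integrable_mul_comp_sub A hp hpt (Lp.memLp u) hk),
        ae_restrict_of_ae (ae_integrable_mul_comp_sub A hp hpt (Lp.memLp u) hgi)]
        with x h1 h2 h3 h4 h5 h6
      rw [sub_apply, h4, Pi.sub_apply, h1, h2, h3, ← integral_sub h5 h6]
      simp_rw [Pi.sub_apply, mul_sub]
    rw [dist_eq_norm, hTS]
    exact (hRn.trans hkg).trans_lt (half_lt_self hε)
  rwa [isClosed_setOfPred_isCompactOperator.closure_eq] at hcl

end Compactness

/-- The cross-correlation operator
`S u(x) = ∫_{Ω_δ} u(y) μ_δ(y−x) dy`, acting from `L^p(Ω_δ)` to `L^p(Ω)`, is a compact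
linear operator: there is a continuous linear map between the Lebesgue spaces that
represents it and is a compact operator. -/
theorem cross_correlation_compact
    {d : ℕ} (hd : 1 ≤ d)
    (Ω : Set (EuclideanSpace ℝ (Fin d))) (hΩo : IsOpen Ω) (hΩb : Bornology.IsBounded Ω)
    (δ : ℝ) (hδ : 0 < δ)
    (Γ : Set (EuclideanSpace ℝ (Fin d))) (hΓ : Γ = (⋃ x ∈ Ω, closedBall x δ) \ Ω)
    (Ωδ : Set (EuclideanSpace ℝ (Fin d))) (hΩδ : Ωδ = Ω ∪ Γ)
    (μ : EuclideanSpace ℝ (Fin d) → ℝ) (hμ : Integrable μ)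
    (hsupp : Function.support μ ⊆ closedBall 0 δ)
    (p : ℝ≥0∞) (hp : 1 ≤ p) (hpfin : p < ∞) [Fact (1 ≤ p)] :
    ∃ T : Lp ℝ p (volume.restrict Ωδ) →L[ℝ] Lp ℝ p (volume.restrict Ω),
      IsCompactOperator T ∧
        ∀ u : Lp ℝ p (volume.restrict Ωδ),
          (T u : EuclideanSpace ℝ (Fin d) → ℝ)
            =ᵐ[volume.restrict Ω] fun x => ∫ y in Ωδ, u y * μ (y - x) := by
  have hΩδb : Bornology.IsBounded Ωδ := by
    refine (hΩb.cthickening (δ := δ)).subset ?_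
    rw [hΩδ, hΓ, union_sdiff_self]
    exact union_subset (self_subset_cthickening Ω)
      (iUnion₂_subset fun x hx => closedBall_subset_cthickening hx δ)
  exact exists_isCompactOperator_crossCorrelation hΩδb hΩb hΩo.measurableSet hpfin.ne hμ
end

section
/- Assume Ω is nonempty and let p ∈ [1,∞). The extended nonlocal derivative D̄_δ, viewed as a bounded linear operator from L^p(Ω_δ) to L^p(Ω_δ), is a compact operator if and only if μ_δ integrates to zero, i.e. ∫_{B_δ(0)} μ_δ(z) dz = 0. -/
open MeasureTheory Metric Set
open scoped ENNReal

theorem eLpNorm_le_of_lintegral_kernel_le {X : Type*} [MeasurableSpace X] {ν : Measure X}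
    [SFinite ν] {k : X → X → ℝ≥0∞} (hk : Measurable (Function.uncurry k)) {C : ℝ≥0∞}
    (hrow : ∀ x, ∫⁻ y, k x y ∂ν ≤ C) (hcol : ∀ y, ∫⁻ x, k x y ∂ν ≤ C)
    {p : ℝ≥0∞} (hp : 1 ≤ p) (hp_top : p ≠ ∞) {f h : X → ℝ} (hf : AEStronglyMeasurable f ν)
    (hh : ∀ᵐ x ∂ν, ‖h x‖ₑ ≤ ∫⁻ y, k x y * ‖f y‖ₑ ∂ν) :
    eLpNorm h p ν ≤ C * eLpNorm f p ν := by
  have hp0 : p ≠ 0 := (zero_lt_one.trans_le hp).ne'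
  have hP : 1 ≤ p.toReal := by simpa using ENNReal.toReal_mono hp_top hp
  rw [eLpNorm_eq_lintegral_rpow_enorm_toReal hp0 hp_top,
    eLpNorm_eq_lintegral_rpow_enorm_toReal hp0 hp_top]
  set P := p.toReal
  have hP0 : 0 < P := by linarith
  have hfm : AEMeasurable (fun y => ‖f y‖ₑ ^ P) ν := hf.enorm.pow_const P
  have hkm (x : X) : Measurable (k x) := hk.comp measurable_prodMk_left
  have holder (x : X) :
      (∫⁻ y, k x y * ‖f y‖ₑ ∂ν) ^ P ≤ C ^ (P - 1) * ∫⁻ y, k x y * ‖f y‖ₑ ^ P ∂ν := by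
    have hexp : (1 - 1 / P) + 1 / P = 1 := by ring
    have h1 : 0 ≤ 1 - 1 / P := by
      rw [sub_nonneg, div_le_one hP0]; exact hP
    have h2 : 0 ≤ 1 / P := by positivity
    have key := ENNReal.lintegral_mul_norm_pow_le (hkm x).aemeasurable
      ((hkm x).aemeasurable.mul hfm) h1 h2 hexp
    have hpt (y : X) : k x y ^ (1 - 1 / P) * (k x * fun y => ‖f y‖ₑ ^ P) y ^ (1 / P)
        = k x y * ‖f y‖ₑ := by
      rw [Pi.mul_apply, ENNReal.mul_rpow_of_nonneg _ _ h2, ← mul_assoc,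
        ← ENNReal.rpow_add_of_nonneg _ _ h1 h2, hexp, ENNReal.rpow_one, ← ENNReal.rpow_mul,
        mul_one_div_cancel hP0.ne', ENNReal.rpow_one]
    simp_rw [hpt] at key
    calc (∫⁻ y, k x y * ‖f y‖ₑ ∂ν) ^ P
        ≤ ((∫⁻ y, k x y ∂ν) ^ (1 - 1 / P) * (∫⁻ y, k x y * ‖f y‖ₑ ^ P ∂ν) ^ (1 / P)) ^ P := by
          gcongr; exact key
      _ = (∫⁻ y, k x y ∂ν) ^ (P - 1) * ∫⁻ y, k x y * ‖f y‖ₑ ^ P ∂ν := by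
          rw [ENNReal.mul_rpow_of_nonneg _ _ hP0.le, ← ENNReal.rpow_mul, ← ENNReal.rpow_mul,
            one_div_mul_cancel hP0.ne', ENNReal.rpow_one]
          congr 2
          field_simp
      _ ≤ _ := by
          gcongr
          exact hrow x
  have hjoint : AEMeasurable (Function.uncurry fun x y => k x y * ‖f y‖ₑ ^ P) (ν.prod ν) :=
    hk.aemeasurable.mul (hfm.comp_quasiMeasurePreserving Measure.quasiMeasurePreserving_snd)
  have main : ∫⁻ x, ‖h x‖ₑ ^ P ∂ν ≤ C ^ P * ∫⁻ y, ‖f y‖ₑ ^ P ∂ν := by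
    calc ∫⁻ x, ‖h x‖ₑ ^ P ∂ν
        ≤ ∫⁻ x, C ^ (P - 1) * ∫⁻ y, k x y * ‖f y‖ₑ ^ P ∂ν ∂ν := by
          refine lintegral_mono_ae (hh.mono fun x hx => ?_)
          exact (ENNReal.rpow_le_rpow hx hP0.le).trans (holder x)
      _ = C ^ (P - 1) * ∫⁻ y, ∫⁻ x, k x y * ‖f y‖ₑ ^ P ∂ν ∂ν := by
          rw [lintegral_const_mul'' _ hjoint.lintegral_prod_right, lintegral_lintegral_swap hjoint]
      _ ≤ C ^ (P - 1) * ∫⁻ y, C * ‖f y‖ₑ ^ P ∂ν := by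
          gcongr with y
          have : Measurable fun x => k x y := hk.comp measurable_prodMk_right
          rw [lintegral_mul_const _ this]
          gcongr
          exact hcol y
      _ = C ^ P * ∫⁻ y, ‖f y‖ₑ ^ P ∂ν := by
          rw [lintegral_const_mul'' _ hfm, ← mul_assoc]
          congr 1
          nth_rewrite 2 [← ENNReal.rpow_one C]
          rw [← ENNReal.rpow_add_of_nonneg _ _ (by linarith) zero_le_one, sub_add_cancel]
  calc (∫⁻ x, ‖h x‖ₑ ^ P ∂ν) ^ (1 / P)
      ≤ (C ^ P * ∫⁻ y, ‖f y‖ₑ ^ P ∂ν) ^ (1 / P) := by gcongr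
    _ = _ := by
      rw [ENNReal.mul_rpow_of_nonneg _ _ (by positivity), ← ENNReal.rpow_mul,
        mul_one_div_cancel hP0.ne', ENNReal.rpow_one]

theorem exists_simpleFunc_dist_lt {E : Type*} [PseudoMetricSpace E] [MeasurableSpace E]
    [OpensMeasurableSpace E] [Nonempty E] {s : Set E} (hs : TotallyBounded s) {r : ℝ}
    (hr : 0 < r) : ∃ φ : SimpleFunc E E, ∀ x ∈ s, dist (φ x) x < r := by
  obtain ⟨t, ht, hst⟩ := Metric.totallyBounded_iff.1 hs r hr
  obtain ⟨e, he⟩ : ∃ e : ℕ → E, t ⊆ range e := by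
    rcases t.eq_empty_or_nonempty with rfl | hne
    · exact ⟨fun _ => Classical.arbitrary E, empty_subset _⟩
    · obtain ⟨e, he⟩ := ht.countable.exists_eq_range hne
      exact ⟨e, he.subset⟩
  obtain ⟨N, hN⟩ : ∃ N : ℕ, ∀ y ∈ t, ∃ k ≤ N, e k = y := by
    choose! n hn using fun y (hy : y ∈ t) => he hy
    obtain ⟨N, hN⟩ := (ht.image n).bddAbove
    exact ⟨N, fun y hy => ⟨n y, hN (mem_image_of_mem n hy), hn y hy⟩⟩
  refine ⟨SimpleFunc.nearestPt e N, fun x hx => ?_⟩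
  obtain ⟨y, hy, hxy⟩ := mem_iUnion₂.1 (hst hx)
  obtain ⟨k, hk, rfl⟩ := hN y hy
  have := SimpleFunc.edist_nearestPt_le e x hk
  rw [edist_dist, edist_dist, ENNReal.ofReal_le_ofReal_iff dist_nonneg] at this
  exact this.trans_lt (by rwa [dist_comm])

theorem IsCompactOperator.of_forall_exists_norm_sub_le {V W : Type*} [NormedAddCommGroup V]
    [NormedSpace ℝ V] [NormedAddCommGroup W] [NormedSpace ℝ W] [CompleteSpace W] {S : V →L[ℝ] W}
    (h : ∀ ε : ℝ, 0 < ε → ∃ F : V →L[ℝ] W, IsCompactOperator F ∧ ‖S - F‖ ≤ ε) :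
    IsCompactOperator S := by
  have : S ∈ closure {F : V →L[ℝ] W | IsCompactOperator F} := by
    refine Metric.mem_closure_iff.2 fun ε hε => ?_
    obtain ⟨F, hF, hSF⟩ := h (ε / 2) (half_pos hε)
    exact ⟨F, hF, by rw [dist_eq_norm]; linarith⟩
  rwa [isClosed_setOfPred_isCompactOperator.closure_eq] at this

theorem isCompactOperator_sum_smulRight {V W ι : Type*} [NormedAddCommGroup V]
    [NormedSpace ℝ V] [NormedAddCommGroup W] [NormedSpace ℝ W] (s : Finset ι)
    (ℓ : ι → V →L[ℝ] ℝ) (w : ι → W) :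
    IsCompactOperator (∑ i ∈ s, (ℓ i).smulRight (w i) : V →L[ℝ] W) := by
  classical
  induction s using Finset.induction_on with
  | empty => simpa using! isCompactOperator_zero
  | insert i s hi ih =>
    rw [Finset.sum_insert hi]
    refine IsCompactOperator.add ?_ ih
    exact (isCompactOperator_of_locallyCompactSpace_dom (ℓ i)).clm_comp
      (ContinuousLinearMap.toSpanSingleton ℝ (w i))

theorem exists_clm_eq_integral_mul_of_bounded {X : Type*} [MeasurableSpace X] {ν : Measure X}
    [IsFiniteMeasure ν] {p : ℝ≥0∞} [Fact (1 ≤ p)] {g : X → ℝ} (hg : AEStronglyMeasurable g ν)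
    {C : ℝ} (hC : ∀ x, ‖g x‖ ≤ C) :
    ∃ ℓ : Lp ℝ p ν →L[ℝ] ℝ, ∀ u, ℓ u = ∫ y, u y * g y ∂ν := by
  have hp : p.HolderConjugate p.conjExponent := .conjExponent Fact.out
  have : Fact (1 ≤ p.conjExponent) := ⟨ENNReal.HolderConjugate.one_le p.conjExponent p⟩
  have hgp : MemLp g p.conjExponent ν := .of_bound hg C (.of_forall hC)
  refine ⟨((ContinuousLinearMap.mul ℝ ℝ).lpPairing ν p p.conjExponent).flip (hgp.toLp g),
    fun u => ?_⟩
  rw [ContinuousLinearMap.flip_apply, ContinuousLinearMap.lpPairing_eq_integral]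
  refine integral_congr_ae (hgp.coeFn_toLp.mono fun x hx => ?_)
  simp [hx]

section Convolution

variable {E : Type*} [NormedAddCommGroup E] [NormedSpace ℝ E] [FiniteDimensional ℝ E]
  [MeasurableSpace E] [BorelSpace E] {lam : Measure E} [lam.IsAddHaarMeasure]

theorem exists_isCompactOperator_ae_eq_indicator_integral {p : ℝ≥0∞} [Fact (1 ≤ p)]
    {ν : Measure E} [IsFiniteMeasure ν] {Ω : Set E} (hΩ : MeasurableSet Ω) (φ : SimpleFunc E E)
    {g : E → ℝ} (hg : Continuous g) {C : ℝ} (hC : ∀ x, ‖g x‖ ≤ C) :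
    ∃ F : Lp ℝ p ν →L[ℝ] Lp ℝ p ν, IsCompactOperator F ∧ ∀ u : Lp ℝ p ν,
      F u =ᵐ[ν] Ω.indicator fun x => ∫ y, u y * g (y - φ x) ∂ν := by
  have hex (v : E) := exists_clm_eq_integral_mul_of_bounded (p := p) (ν := ν)
    (g := fun y => g (y - v)) (by fun_prop) (fun y => hC (y - v))
  choose ℓ hℓ using hex
  let w (v : E) : Lp ℝ p ν :=
    indicatorConstLp p ((φ.measurableSet_fiber v).inter hΩ) (measure_ne_top ν _) 1
  refine ⟨∑ v ∈ φ.range, (ℓ v).smulRight (w v), isCompactOperator_sum_smulRight _ _ _,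
    fun u => ?_⟩
  have hw : ∀ᵐ x ∂ν, ∀ v ∈ φ.range,
      (ℓ v u • w v : Lp ℝ p ν) x = ℓ v u * (φ ⁻¹' {v} ∩ Ω).indicator (fun _ => 1) x := by
    rw [Finset.eventually_all]
    intro v _
    filter_upwards [Lp.coeFn_smul (ℓ v u) (w v), indicatorConstLp_coeFn (p := p)
      (hs := (φ.measurableSet_fiber v).inter hΩ) (hμs := measure_ne_top ν _) (c := (1 : ℝ))]
      with x h1 h2
    rw [h1, Pi.smul_apply, h2, smul_eq_mul]
  have hsum : (∑ v ∈ φ.range, (ℓ v).smulRight (w v)) u = ∑ v ∈ φ.range, ℓ v u • w v := by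
    simp
  rw [hsum]
  filter_upwards [Lp.coeFn_fun_finsetSum φ.range fun v => ℓ v u • w v, hw] with x h1 h2
  rw [h1, Finset.sum_congr rfl h2, Finset.sum_eq_single (φ x)]
  · by_cases hx : x ∈ Ω <;> simp [hx, hℓ]
  · intro v _ hv
    rw [indicator_of_notMem (fun h => hv h.1.symm), mul_zero]
  · intro h
    exact absurd (φ.mem_range_self x) h

theorem isCompactOperator_of_ae_eq_indicator_integral_of_stronglyMeasurable {p : ℝ≥0∞}
    [Fact (1 ≤ p)] (hp : p ≠ ∞) {W Ω : Set E} (hW : lam W ≠ ∞) (hΩ : MeasurableSet Ω)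
    (hΩb : Bornology.IsBounded Ω) {m : E → ℝ} (hm : Integrable m lam)
    (hmm : StronglyMeasurable m)
    {S : Lp ℝ p (lam.restrict W) →L[ℝ] Lp ℝ p (lam.restrict W)}
    (hS : ∀ u : Lp ℝ p (lam.restrict W),
      S u =ᵐ[lam.restrict W] Ω.indicator fun x => ∫ y in W, u y * m (y - x) ∂lam) :
    IsCompactOperator S := by
  have : IsFiniteMeasure (lam.restrict W) := ⟨by simpa using hW.lt_top⟩
  refine .of_forall_exists_norm_sub_le fun ε hε => ?_
  set V := (lam W).toReal
  have hV : 0 ≤ V := ENNReal.toReal_nonneg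
  obtain ⟨g, hgs, hmg, hgc, -⟩ := hm.exists_hasCompactSupport_lintegral_sub_le
    (ε := ENNReal.ofReal (ε / 2)) (by simpa using hε)
  obtain ⟨C, hC⟩ := hgs.exists_bound_of_continuous hgc
  set η := ε / (2 * (V + 1))
  have hη : 0 < η := by positivity
  have hηV : η * V ≤ ε / 2 := by
    simp only [η]
    rw [div_mul_eq_mul_div, div_le_div_iff₀ (by positivity) two_pos]
    nlinarith
  obtain ⟨r, hr, hgr⟩ :=
    Metric.uniformContinuous_iff.1 (hgs.uniformContinuous_of_continuous hgc) η hη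
  obtain ⟨φ, hφ⟩ := exists_simpleFunc_dist_lt
    (hΩb.isCompact_closure.totallyBounded.subset subset_closure) hr
  obtain ⟨F, hF, hFu⟩ :=
    exists_isCompactOperator_ae_eq_indicator_integral (p := p) (ν := lam.restrict W) hΩ φ hgc hC
  refine ⟨F, hF, ContinuousLinearMap.opNorm_le_bound _ hε.le fun u => ?_⟩
  let k (x y : E) : ℝ≥0∞ := Ω.indicator (fun x => ‖m (y - x) - g (y - φ x)‖ₑ) x
  have hk : Measurable (Function.uncurry k) := by
    have h0 : Measurable fun z : E × E => ‖m (z.2 - z.1) - g (z.2 - φ z.1)‖ₑ :=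
      ((hmm.measurable.comp (measurable_snd.sub measurable_fst)).sub
        (hgc.measurable.comp (measurable_snd.sub (φ.measurable.comp measurable_fst)))).enorm
    exact h0.indicator (hΩ.preimage measurable_fst)
  have hk_le (x y : E) : k x y ≤ ‖m (y - x) - g (y - x)‖ₑ + ENNReal.ofReal η := by
    by_cases hx : x ∈ Ω
    · have hclose : dist (y - x) (y - φ x) < r := by
        rw [dist_sub_left, dist_comm]; exact hφ x hx
      have := (hgr hclose).le
      rw [← ENNReal.ofReal_le_ofReal_iff hη.le, ← edist_dist, edist_eq_enorm_sub] at this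
      calc k x y = ‖(m (y - x) - g (y - x)) + (g (y - x) - g (y - φ x))‖ₑ := by
            simp [k, hx]
        _ ≤ _ := (enorm_add_le _ _).trans (by gcongr)
    · simp [k, hx]
  have htotal {f : E → E} (hf : MeasurePreserving f lam lam) :
      ∫⁻ z in W, (‖m (f z) - g (f z)‖ₑ + ENNReal.ofReal η) ∂lam ≤ ENNReal.ofReal ε := by
    rw [lintegral_add_right _ measurable_const, setLIntegral_const]
    calc _ ≤ ∫⁻ z, ‖m (f z) - g (f z)‖ₑ ∂lam + ENNReal.ofReal η * lam W := by
          gcongr; exact Measure.restrict_le_self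
      _ ≤ ENNReal.ofReal (ε / 2) + ENNReal.ofReal (ε / 2) := by
          gcongr
          · rw [hf.lintegral_comp (f := fun z => ‖m z - g z‖ₑ)
              (hmm.measurable.sub hgc.measurable).enorm]
            exact hmg
          · rw [← ENNReal.ofReal_toReal hW, ← ENNReal.ofReal_mul hη.le]
            exact ENNReal.ofReal_le_ofReal hηV
      _ = ENNReal.ofReal ε := by
          rw [← ENNReal.ofReal_add (by positivity) (by positivity), add_halves]
  have key : eLpNorm ((S - F) u) p (lam.restrict W)
      ≤ ENNReal.ofReal ε * eLpNorm u p (lam.restrict W) := by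
    refine eLpNorm_le_of_lintegral_kernel_le hk (fun x => ?_) (fun y => ?_) Fact.out hp
      (Lp.aestronglyMeasurable u) ?_
    · exact (lintegral_mono (hk_le x)).trans (htotal (measurePreserving_sub_right lam x))
    · exact (lintegral_mono fun x => hk_le x y).trans (htotal (Measure.measurePreserving_sub_left lam y))
    · have hu : Integrable u (lam.restrict W) := (Lp.memLp u).integrable Fact.out
      filter_upwards [Lp.coeFn_sub (S u) (F u), hS u, hFu u] with x h1 h2 h3
      rw [sub_apply, h1, Pi.sub_apply, h2, h3]
      by_cases hx : x ∈ Ω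
      · simp only [indicator_of_mem hx, k]
        have hug : Integrable (fun y => u y * g (y - φ x)) (lam.restrict W) :=
          hu.mul_bdd (c := C) (by fun_prop) (.of_forall fun y => hC _)
        have hum : AEStronglyMeasurable (fun y => u y * m (y - x)) (lam.restrict W) :=
          hu.1.mul (hmm.comp_measurable (measurable_id.sub_const x)).aestronglyMeasurable
        have hdiff (y : E) : ‖m (y - x) - g (y - φ x)‖ₑ * ‖u y‖ₑ
            = ‖u y * m (y - x) - u y * g (y - φ x)‖ₑ := by
          rw [← mul_sub, enorm_mul, mul_comm]
        simp_rw [hdiff]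
        rcases eq_or_ne (∫⁻ y in W, ‖u y * m (y - x) - u y * g (y - φ x)‖ₑ ∂lam) ∞ with htop | hfin
        · rw [htop]; exact le_top
        · have hd : Integrable (fun y => u y * m (y - x) - u y * g (y - φ x)) (lam.restrict W) :=
            ⟨hum.sub hug.1, hfin.lt_top⟩
          have hum' : Integrable (fun y => u y * m (y - x)) (lam.restrict W) := by
            refine (hd.add hug).congr (.of_forall fun y => ?_)
            exact sub_add_cancel _ _
          rw [← integral_sub hum' hug]
          exact enorm_integral_le_lintegral_enorm _
      · simp [hx]
  calc ‖(S - F) u‖ ≤ (ENNReal.ofReal ε * eLpNorm u p (lam.restrict W)).toReal := ?_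
    _ = ε * ‖u‖ := by rw [ENNReal.toReal_mul, ENNReal.toReal_ofReal hε.le, Lp.norm_def]
  rw [Lp.norm_def]
  exact ENNReal.toReal_mono (ENNReal.mul_ne_top ENNReal.ofReal_ne_top (Lp.eLpNorm_ne_top u)) key

theorem isCompactOperator_of_ae_eq_indicator_integral {p : ℝ≥0∞} [Fact (1 ≤ p)] (hp : p ≠ ∞)
    {W Ω : Set E} (hW : lam W ≠ ∞) (hΩ : MeasurableSet Ω) (hΩb : Bornology.IsBounded Ω)
    {m : E → ℝ} (hm : Integrable m lam)
    {S : Lp ℝ p (lam.restrict W) →L[ℝ] Lp ℝ p (lam.restrict W)}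
    (hS : ∀ u : Lp ℝ p (lam.restrict W),
      S u =ᵐ[lam.restrict W] Ω.indicator fun x => ∫ y in W, u y * m (y - x) ∂lam) :
    IsCompactOperator S := by
  refine isCompactOperator_of_ae_eq_indicator_integral_of_stronglyMeasurable hp hW hΩ hΩb
    (hm.congr hm.1.ae_eq_mk) hm.1.stronglyMeasurable_mk fun u => (hS u).trans (.of_eq ?_)
  congr! 2 with x
  refine integral_congr_ae (ae_restrict_of_ae ?_)
  filter_upwards [(measurePreserving_sub_right lam x).quasiMeasurePreserving.ae_eq_comp
    hm.1.ae_eq_mk] with y hy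
  exact congrArg (u y * ·) hy

theorem ae_integrable_mul_comp_sub_s17 {W : Set E} (hW : MeasurableSet W) {u m : E → ℝ}
    (hu : Integrable u (lam.restrict W)) (hm : Integrable m lam) :
    ∀ᵐ x ∂lam, Integrable (fun y => u y * m (y - x)) (lam.restrict W) := by
  filter_upwards [Integrable.ae_convolution_exists (ContinuousLinearMap.mul ℝ ℝ)
    ((integrable_indicator_iff hW).2 hu) hm.comp_neg] with x hx
  have h : Integrable (fun y => W.indicator u y * m (y - x)) lam := by
    simpa [ConvolutionExistsAt] using hx
  refine (h.restrict (s := W)).congr ?_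
  filter_upwards [ae_restrict_mem hW] with y hy
  rw [indicator_of_mem hy]

end Convolution

theorem exists_clm_ae_eq_indicator {X : Type*} [MeasurableSpace X] (ν : Measure X)
    [IsFiniteMeasure ν] (p : ℝ≥0∞) [Fact (1 ≤ p)] {A : Set X} (hA : MeasurableSet A) :
    ∃ M : Lp ℝ p ν →L[ℝ] Lp ℝ p ν, ∀ u : Lp ℝ p ν, M u =ᵐ[ν] A.indicator u := by
  refine ⟨(ContinuousLinearMap.mul ℝ ℝ).holderL ν ∞ p p
    (indicatorConstLp ∞ hA (measure_ne_top ν _) 1), fun u => ?_⟩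
  filter_upwards [ContinuousLinearMap.coeFn_holder (r := p) (ContinuousLinearMap.mul ℝ ℝ)
    (indicatorConstLp ∞ hA (measure_ne_top ν _) 1) u, indicatorConstLp_coeFn (p := ∞)
      (hs := hA) (hμs := measure_ne_top ν _) (c := (1 : ℝ))] with x h1 h2
  rw [ContinuousLinearMap.holderL_apply_apply, h1, h2]
  by_cases hx : x ∈ A <;> simp [hx]

theorem not_isCompactOperator_of_ae_eq_indicator {X : Type*} [TopologicalSpace X] [T2Space X]
    [MeasurableSpace X] [OpensMeasurableSpace X] {ν : Measure X} [IsFiniteMeasure ν] {p : ℝ≥0∞}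
    [Fact (1 ≤ p)] {Ω : Set X} (hΩ : IsOpen Ω) (hΩi : Ω.Infinite)
    (hν : ∀ U ⊆ Ω, IsOpen U → U.Nonempty → ν U ≠ 0)
    {M : Lp ℝ p ν →L[ℝ] Lp ℝ p ν} (hM : ∀ u : Lp ℝ p ν, M u =ᵐ[ν] Ω.indicator u) :
    ¬ IsCompactOperator M := by
  intro hMc
  have := hΩi.to_subtype
  obtain ⟨U, hUi, hUo, hUd⟩ := exists_seq_infinite_isOpen_pairwise_disjoint Ω
  let B (n : ℕ) : Set X := (↑) '' U n
  have hBo (n : ℕ) : IsOpen (B n) := hΩ.isOpenMap_subtype_val _ (hUo n)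
  have hBΩ (n : ℕ) : B n ⊆ Ω := Subtype.coe_image_subset Ω (U n)
  have hBd {i j : ℕ} (hij : i ≠ j) : Disjoint (B i) (B j) :=
    (disjoint_image_iff Subtype.val_injective).2 (hUd hij)
  have hBν (n : ℕ) : ν (B n) ≠ 0 := hν _ (hBΩ n) (hBo n) ((hUi n).nonempty.image _)
  let w (n : ℕ) : Lp ℝ p ν := indicatorConstLp p (hBo n).measurableSet (measure_ne_top ν _) 1
  have hwx (n : ℕ) : w n =ᵐ[ν] (B n).indicator fun _ => 1 := indicatorConstLp_coeFn
  have hw (n : ℕ) : w n ≠ 0 := by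
    intro h
    have h0 : (B n).indicator (fun _ => (1 : ℝ)) =ᵐ[ν] 0 :=
      (hwx n).symm.trans (h ▸ Lp.coeFn_zero ℝ p ν)
    refine hBν n (measure_mono_null (fun x hx => ?_) (ae_iff.1 h0))
    simp [hx]
  let u (n : ℕ) : Lp ℝ p ν := ‖w n‖⁻¹ • w n
  have hu (n : ℕ) : ‖u n‖ = 1 := norm_smul_inv_norm (hw n)
  have hux (n : ℕ) : ∀ᵐ x ∂ν, x ∉ B n → u n x = 0 := by
    filter_upwards [hwx n, Lp.coeFn_smul ‖w n‖⁻¹ (w n)] with x h1 h2 hx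
    rw [h2, Pi.smul_apply, h1, indicator_of_notMem hx, smul_zero]
  have hMu (n : ℕ) : M (u n) = u n := by
    refine Lp.ext ?_
    filter_upwards [hM (u n), hux n] with x h1 h2
    rw [h1]
    by_cases hx : x ∈ Ω
    · simp [hx]
    · rw [indicator_of_notMem hx, h2 fun h => hx (hBΩ n h)]
  have hsep {i j : ℕ} (hij : i ≠ j) : 1 ≤ dist (u i) (u j) := by
    rw [dist_eq_norm, ← hu i]
    refine Lp.norm_le_norm_of_ae_le ?_
    filter_upwards [Lp.coeFn_sub (u i) (u j), hux i, hux j] with x h1 h2 h3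
    rw [h1, Pi.sub_apply]
    by_cases hx : x ∈ B i
    · rw [h3 ((hBd hij).notMem_of_mem_left hx), sub_zero]
    · rw [h2 hx, norm_zero]; positivity
  obtain ⟨K, hK, hMK⟩ := IsCompactOperator.image_closedBall_subset_compact (f := M.toLinearMap) hMc 1
  obtain ⟨a, -, φ, hφ, ha⟩ := hK.tendsto_subseq (x := u) fun n =>
    hMK ⟨u n, by simp [hu n], hMu n⟩
  obtain ⟨N, hN⟩ := Metric.cauchySeq_iff'.1 ha.cauchySeq 1 one_pos
  exact (hN (N + 1) N.le_succ).not_ge (hsep (hφ N.lt_succ_self).ne')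

section Thickening

open scoped Pointwise

variable {E : Type*} [SeminormedAddCommGroup E] {s : Set E}

theorem biUnion_closedBall_eq_add (s : Set E) (r : ℝ) :
    ⋃ x ∈ s, closedBall x r = s + closedBall 0 r := by
  rw [← iUnion_add_left_image]
  simp

theorem isOpen_biUnion_closedBall (hs : IsOpen s) (r : ℝ) : IsOpen (⋃ x ∈ s, closedBall x r) :=
  biUnion_closedBall_eq_add s r ▸ hs.add_right

theorem isBounded_biUnion_closedBall (hs : Bornology.IsBounded s) (r : ℝ) :
    Bornology.IsBounded (⋃ x ∈ s, closedBall x r) :=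
  biUnion_closedBall_eq_add s r ▸ hs.add isBounded_closedBall

end Thickening

theorem ball_ae_eq_closedBall {E : Type*} [NormedAddCommGroup E] [NormedSpace ℝ E]
    [FiniteDimensional ℝ E] [MeasurableSpace E] [BorelSpace E] (lam : Measure E)
    [lam.IsAddHaarMeasure] (x : E) {r : ℝ} (hr : r ≠ 0) : ball x r =ᵐ[lam] closedBall x r := by
  refine ball_subset_closedBall.eventuallyLE.antisymm (ae_le_set.2 ?_)
  rw [closedBall_sdiff_ball]
  exact Measure.addHaar_sphere_of_ne_zero lam x hr

/-- The extended nonlocal derivative `D̄_δ`, viewed as a bounded linear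
operator on `L^p(Ω_δ)`, is compact if and only if the kernel integrates to zero:
`∫_{B_δ(0)} μ_δ = 0`. -/
theorem nonlocal_derivative_compact_iff
    {d : ℕ} (hd : 1 ≤ d)
    (Ω : Set (EuclideanSpace ℝ (Fin d))) (hΩo : IsOpen Ω) (hΩb : Bornology.IsBounded Ω)
    (hΩne : Ω.Nonempty)
    (δ : ℝ) (hδ : 0 < δ)
    (Γ : Set (EuclideanSpace ℝ (Fin d))) (hΓ : Γ = (⋃ x ∈ Ω, closedBall x δ) \ Ω)
    (Ωδ : Set (EuclideanSpace ℝ (Fin d))) (hΩδ : Ωδ = Ω ∪ Γ)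
    (μ : EuclideanSpace ℝ (Fin d) → ℝ) (hμ : Integrable μ)
    (hsupp : Function.support μ ⊆ closedBall 0 δ)
    (p : ℝ≥0∞) (hp : 1 ≤ p) (hpfin : p < ∞) [Fact (1 ≤ p)]
    (T : Lp ℝ p (volume.restrict Ωδ) →L[ℝ] Lp ℝ p (volume.restrict Ωδ))
    (hT : ∀ u : Lp ℝ p (volume.restrict Ωδ),
      (T u : EuclideanSpace ℝ (Fin d) → ℝ)
        =ᵐ[volume.restrict Ωδ] fun x =>
          Ω.indicator (fun _ => (1:ℝ)) x * ∫ y in Ωδ, (u y - u x) * μ (y - x)) :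
    IsCompactOperator T ↔ (∫ z in ball (0 : EuclideanSpace ℝ (Fin d)) δ, μ z) = 0 := by
  have hunion : Ωδ = ⋃ x ∈ Ω, closedBall x δ := by
    rw [hΩδ, hΓ, union_sdiff_self, union_eq_right]
    exact fun x hx => mem_biUnion hx (mem_closedBall_self hδ.le)
  have hball {x} (hx : x ∈ Ω) : closedBall x δ ⊆ Ωδ := 
    hunion ▸ subset_biUnion_of_mem (u := fun x => closedBall x δ) hx
  have hΩsub : Ω ⊆ Ωδ := hΩδ ▸ subset_union_left
  have hmeas : MeasurableSet Ωδ := hunion ▸ (isOpen_biUnion_closedBall hΩo δ).measurableSet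
  have hfin : volume Ωδ ≠ ∞ := hunion ▸ (isBounded_biUnion_closedBall hΩb δ).measure_lt_top.ne
  have : IsFiniteMeasure (volume.restrict Ωδ) := ⟨by simpa using hfin.lt_top⟩
  set c := ∫ z in ball (0 : EuclideanSpace ℝ (Fin d)) δ, μ z with hc
  have hint {x} (hx : x ∈ Ω) : ∫ y in Ωδ, μ (y - x) = c := by
    have hsub : Function.support (fun y => μ (y - x)) ⊆ Ωδ := fun y hy =>
      hball hx (by simpa [dist_eq_norm] using hsupp hy)
    rw [setIntegral_eq_integral_of_forall_compl_eq_zero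
      fun y hy => Function.notMem_support.1 fun h => hy (hsub h),
      integral_sub_right_eq_self μ x, hc,
      setIntegral_congr_set (ball_ae_eq_closedBall volume 0 hδ.ne')]
    exact (setIntegral_eq_integral_of_forall_compl_eq_zero
      fun y hy => Function.notMem_support.1 fun h => hy (hsupp h)).symm
  obtain ⟨M, hM⟩ := exists_clm_ae_eq_indicator (volume.restrict Ωδ) p hΩo.measurableSet
  have hS : IsCompactOperator (T + c • M) := by
    refine isCompactOperator_of_ae_eq_indicator_integral (lam := volume) hpfin.ne hfin
      hΩo.measurableSet hΩb hμ fun u => ?_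
    filter_upwards [Lp.coeFn_add (T u) (c • M u), Lp.coeFn_smul c (M u), hT u, hM u,
      ae_restrict_of_ae (ae_integrable_mul_comp_sub_s17 hmeas ((Lp.memLp u).integrable hp) hμ)]
      with x h1 h2 h3 h4 h5
    rw [add_apply, smul_apply, h1, Pi.add_apply, h2, Pi.smul_apply, h3, h4]
    by_cases hx : x ∈ Ω
    · simp only [indicator_of_mem hx, one_mul, sub_mul]
      rw [integral_sub h5 ((hμ.comp_sub_right x).restrict.const_mul _), integral_const_mul,
        hint hx, smul_eq_mul]
      ring
    · simp [hx]
  constructor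
  · intro hTc
    by_contra hc0
    have hcM : IsCompactOperator (c • M) := by
      have := hS.sub hTc
      rwa [← FunLike.coe_sub, add_sub_cancel_left] at this
    have : Nonempty (Fin d) := ⟨⟨0, hd⟩⟩
    obtain ⟨x, hx⟩ := hΩne
    refine not_isCompactOperator_of_ae_eq_indicator hΩo
      (infinite_of_mem_nhds x (hΩo.mem_nhds hx)) (fun U hU hUo hUne => ?_) hM
      ((IsCompactOperator.smul_iff₀ hc0).1 hcM)
    rw [Measure.restrict_eq_self _ (hU.trans hΩsub)]
    exact (hUo.measure_pos volume hUne).ne'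
  · intro hc0
    simpa [hc0] using hS
end
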